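/- (Exact minimizer of the Euclidean ℓ²-TV signal model) Let H be a real Hilbert space, p₁, p₂ ∈ H with p₁ ≠ p₂, and α > 0. Define the data f : Fin 30 → H by f_i = p₁ for i ≤ 15 and f_i = p₂ for i > 15 (indices 1,…,30). Let δ = min( α / (15 · ‖p₁ − p₂‖), 1/2 ), and define p̂ : Fin 30 → H by p̂_i = p₁ + δ·(p₂ − p₁) for i ≤ 15 and p̂_i = p₂ + δ·(p₁ − p₂) for i > 15. Then p̂ is the unique minimizer over all p : Fin 30 → H of the ℓ²-TV energy E(p) = (1/(2α)) · Σ_{i=1}^{30} ‖f_i − p_i‖² + Σ_{i=1}^{29} ‖p_{i+1} − p_i‖. (This is the closed-form minimizer asserted in Section 6.1 of the paper, specialized to the Euclidean/Hilbert case where geodesics are straight line segments.) -/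

import Mathlib

/-- The discrete `ℓ²`-TV energy of a signal `p : Fin 30 → H` with data `f` and
regularization parameter `α`. -/
noncomputable def tvEnergy {H : Type*} [NormedAddCommGroup H] [InnerProductSpace ℝ H]
    (α : ℝ) (f p : Fin 30 → H) : ℝ :=
  (1 / (2 * α)) * ∑ i : Fin 30, ‖f i - p i‖ ^ 2 +
    ∑ i : Fin 29, ‖p i.succ - p i.castSucc‖

/-- The piecewise constant data signal: `p₁` on the first 15 entries, `p₂` on the rest. -/
def tvData {H : Type*} [NormedAddCommGroup H] [InnerProductSpace ℝ H]
    (p₁ p₂ : H) : Fin 30 → H :=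
  fun i => if (i : ℕ) < 15 then p₁ else p₂

/-- The claimed exact minimizer of the Euclidean `ℓ²`-TV signal model. -/
noncomputable def tvMinimizer {H : Type*} [NormedAddCommGroup H] [InnerProductSpace ℝ H]
    (p₁ p₂ : H) (α : ℝ) : Fin 30 → H :=
  fun i =>
    if (i : ℕ) < 15 then p₁ + min (α / (15 * ‖p₁ - p₂‖)) (1 / 2) • (p₂ - p₁)
    else p₂ + min (α / (15 * ‖p₁ - p₂‖)) (1 / 2) • (p₁ - p₂)

/-- First-order optimality for the `ℓ²`-TV energy: if the residual `f - q` is bounded by `α` times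
the total variation, with equality at `q`, then `q` minimizes the energy with quadratic growth. -/
theorem tvEnergy_add_le_of_dual_certificate {H : Type*} [NormedAddCommGroup H]
    [InnerProductSpace ℝ H] {α : ℝ} (hα : 0 < α) (f q p : Fin 30 → H)
    (hp : ∑ i, inner ℝ (f i - q i) (p i) ≤ α * ∑ i : Fin 29, ‖p i.succ - p i.castSucc‖)
    (hq : α * ∑ i : Fin 29, ‖q i.succ - q i.castSucc‖ ≤ ∑ i, inner ℝ (f i - q i) (q i)) :
    tvEnergy α f q + (1 / (2 * α)) * ∑ i, ‖q i - p i‖ ^ 2 ≤ tvEnergy α f p := by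
  have hexp : ∑ i, ‖f i - p i‖ ^ 2 = ∑ i, ‖f i - q i‖ ^ 2 +
      2 * (∑ i, inner ℝ (f i - q i) (q i) - ∑ i, inner ℝ (f i - q i) (p i)) +
      ∑ i, ‖q i - p i‖ ^ 2 := by
    rw [← Finset.sum_sub_distrib, Finset.mul_sum, ← Finset.sum_add_distrib,
      ← Finset.sum_add_distrib]
    refine Finset.sum_congr rfl fun i _ => ?_
    rw [← inner_sub_right, ← norm_add_sq_real, sub_add_sub_cancel]
  unfold tvEnergy
  rw [hexp]
  generalize ∑ i, ‖f i - q i‖ ^ 2 = a at *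
  generalize ∑ i, ‖q i - p i‖ ^ 2 = b at *
  generalize ∑ i, inner ℝ (f i - q i) (q i) = c at *
  generalize ∑ i, inner ℝ (f i - q i) (p i) = d at *
  generalize ∑ i : Fin 29, ‖q i.succ - q i.castSucc‖ = t at *
  generalize ∑ i : Fin 29, ‖p i.succ - p i.castSucc‖ = u at *
  have h : t - u ≤ (c - d) / α := by
    rw [le_div_iff₀ hα]
    linarith
  have h' : 1 / (2 * α) * (a + 2 * (c - d) + b) =
      1 / (2 * α) * a + (c - d) / α + 1 / (2 * α) * b := by
    field_simp
  linarith

/-- Summation by parts against the step sign pattern; the weights are the tent function. -/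
theorem sum_step_sign_eq_sum_tent_mul_sub (a : Fin 30 → ℝ) :
    ∑ i : Fin 30, (if (i : ℕ) < 15 then -a i else a i) =
      ∑ k : Fin 29, (min (k + 1) (29 - k) : ℕ) * (a k.succ - a k.castSucc) := by
  simp [Fin.sum_univ_succ, Fin.succ, -Nat.cast_min]
  ring

/-- A step signal on `Fin 30` has only one jump. -/
theorem sum_norm_sub_step {E : Type*} [SeminormedAddCommGroup E] (x y : E) (p : Fin 30 → E)
    (hp : ∀ i, p i = if (i : ℕ) < 15 then x else y) :
    ∑ i : Fin 29, ‖p i.succ - p i.castSucc‖ = ‖y - x‖ := by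
  rw [Finset.sum_eq_single (14 : Fin 29)]
  · simp [hp]
  · intro k _ hk
    have hk' : (k : ℕ) ≠ 14 := fun h => hk (Fin.ext h)
    have h : ((k : ℕ) + 1 < 15) ↔ (k : ℕ) < 15 := by omega
    simp [hp, h]
  · simp

/-- The sum of a step function on `Fin 30`. -/
theorem sum_step_eq (x y : ℝ) :
    ∑ i : Fin 30, (if (i : ℕ) < 15 then x else y) = 15 * x + 15 * y := by
  simp [Fin.sum_univ_succ]
  ring

/-- The piecewise constant signal `tvMinimizer p₁ p₂ α` is the unique minimizer of the
`ℓ²`-TV energy with data `tvData p₁ p₂`. -/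
theorem tv_exact_minimizer {H : Type*} [NormedAddCommGroup H] [InnerProductSpace ℝ H]
    (p₁ p₂ : H) (hne : p₁ ≠ p₂) (α : ℝ) (hα : 0 < α) :
    ∀ p : Fin 30 → H,
      tvEnergy α (tvData p₁ p₂) (tvMinimizer p₁ p₂ α) ≤ tvEnergy α (tvData p₁ p₂) p ∧
      (tvEnergy α (tvData p₁ p₂) (tvMinimizer p₁ p₂ α) = tvEnergy α (tvData p₁ p₂) p →
        p = tvMinimizer p₁ p₂ α) := by
  intro p
  have hD : 0 < ‖p₂ - p₁‖ := norm_pos_iff.mpr (sub_ne_zero.mpr hne.symm)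
  obtain ⟨δ, hδ⟩ : ∃ δ, δ = min (α / (15 * ‖p₁ - p₂‖)) (1 / 2) := ⟨_, rfl⟩
  have hq : ∀ i, tvMinimizer p₁ p₂ α i =
      if (i : ℕ) < 15 then p₁ + δ • (p₂ - p₁) else p₂ + δ • (p₁ - p₂) := fun i => by
    rw [hδ]; rfl
  rw [norm_sub_rev] at hδ
  have hδ0 : 0 ≤ δ := hδ ▸ le_min (by positivity) (by norm_num)
  have hδ_half : δ ≤ 1 / 2 := hδ ▸ min_le_right _ _
  have hδα : δ * (15 * ‖p₂ - p₁‖) ≤ α :=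
    (le_div_iff₀ (by positivity)).mp (hδ ▸ min_le_left _ _)
  have hcompl : (1 - 2 * δ) * (δ * (15 * ‖p₂ - p₁‖)) = (1 - 2 * δ) * α := by
    rcases min_choice (α / (15 * ‖p₂ - p₁‖)) (1 / 2) with h | h
    · rw [hδ, h, div_mul_cancel₀ α (by positivity)]
    · rw [hδ, h]; norm_num
  have hres : ∀ (i : Fin 30) (v : H),
      inner ℝ (tvData p₁ p₂ i - tvMinimizer p₁ p₂ α i) v =
        δ * (if (i : ℕ) < 15 then -inner ℝ (p₂ - p₁) v else inner ℝ (p₂ - p₁) v) := by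
    intro i v
    rw [hq, tvData]
    split_ifs
    · rw [sub_add_cancel_left, inner_neg_left, real_inner_smul_left, mul_neg]
    · rw [sub_add_cancel_left, ← smul_neg, neg_sub, real_inner_smul_left]
  have hgrowth := tvEnergy_add_le_of_dual_certificate hα (tvData p₁ p₂)
    (tvMinimizer p₁ p₂ α) p ?_ ?_
  · have hnonneg : 0 ≤ ∑ i, ‖tvMinimizer p₁ p₂ α i - p i‖ ^ 2 :=
      Finset.sum_nonneg fun i _ => by positivity
    have hcoef : 0 < 1 / (2 * α) := by positivity
    refine ⟨by nlinarith, fun heq => ?_⟩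
    have hzero : ∑ i, ‖tvMinimizer p₁ p₂ α i - p i‖ ^ 2 = 0 := by nlinarith
    funext i
    have hi := (Finset.sum_eq_zero_iff_of_nonneg fun i _ => by positivity).mp hzero i
      (Finset.mem_univ i)
    exact (sub_eq_zero.mp (norm_eq_zero.mp (pow_eq_zero_iff two_ne_zero |>.mp hi))).symm
  · simp only [hres]
    rw [← Finset.mul_sum, sum_step_sign_eq_sum_tent_mul_sub fun i => inner ℝ (p₂ - p₁) (p i),
      Finset.mul_sum, Finset.mul_sum]
    refine Finset.sum_le_sum fun k _ => ?_
    rw [← inner_sub_right]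
    have hk : ((min (k + 1) (29 - k) : ℕ) : ℝ) ≤ 15 := by
      exact_mod_cast (by omega : min ((k : ℕ) + 1) (29 - k) ≤ 15)
    calc δ * (((min (k + 1) (29 - k) : ℕ) : ℝ) * inner ℝ (p₂ - p₁) (p k.succ - p k.castSucc))
        ≤ δ * (15 * (‖p₂ - p₁‖ * ‖p k.succ - p k.castSucc‖)) := by
          refine mul_le_mul_of_nonneg_left (le_trans (mul_le_mul_of_nonneg_left
            (real_inner_le_norm _ _) (Nat.cast_nonneg _)) ?_) hδ0
          gcongr
      _ = δ * (15 * ‖p₂ - p₁‖) * ‖p k.succ - p k.castSucc‖ := by ring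
      _ ≤ α * ‖p k.succ - p k.castSucc‖ := by gcongr
  · rw [sum_norm_sub_step _ _ _ hq]
    have hjump : p₂ + δ • (p₁ - p₂) - (p₁ + δ • (p₂ - p₁)) = (1 - 2 * δ) • (p₂ - p₁) := by
      module
    have hinner : inner ℝ (p₂ - p₁) (p₂ + δ • (p₁ - p₂)) -
        inner ℝ (p₂ - p₁) (p₁ + δ • (p₂ - p₁)) = (1 - 2 * δ) * ‖p₂ - p₁‖ ^ 2 := by
      rw [← inner_sub_right, hjump, real_inner_smul_right, real_inner_self_eq_norm_sq]
    have hsum : ∑ i, inner ℝ (tvData p₁ p₂ i - tvMinimizer p₁ p₂ α i) (tvMinimizer p₁ p₂ α i) =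
        δ * (15 * -inner ℝ (p₂ - p₁) (p₁ + δ • (p₂ - p₁)) +
          15 * inner ℝ (p₂ - p₁) (p₂ + δ • (p₁ - p₂))) := by
      rw [← sum_step_eq, Finset.mul_sum]
      refine Finset.sum_congr rfl fun i _ => ?_
      rw [hres, hq]
      split_ifs <;> rfl
    rw [hsum, hjump, norm_smul, Real.norm_of_nonneg (by linarith)]
    refine le_of_eq ?_
    linear_combination (-‖p₂ - p₁‖) * hcompl - 15 * δ * hinner
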